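/- Let a, b, c, m, n be positive integers with 1 ≤ a < 2^(n+1), m ≥ n + 2 + ⌊log₂ b⌋, and c odd. Then ν₂(S(c·2^m + b·2^(n+1) + 2^n, b·2^(n+2) + a)) equals n if a = 2^(n+1) − 1, and is at least s₂(a) if a < 2^(n+1) − 1. -/

import Mathlib

/-- Stirling numbers of the second kind. -/
def S : ℕ → ℕ → ℕ
  | 0, 0 => 1
  | 0, _ + 1 => 0
  | _ + 1, 0 => 0
  | n + 1, k + 1 => S n k + (k + 1) * S n (k + 1)

/-- Sum of binary digits. -/
def s₂ (n : ℕ) : ℕ := (Nat.digits 2 n).sum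

/-- The function `y ↦ 4 ^ k * choose y k`. -/
def scaledChoose (k : ℕ) : ℕ → ℚ := fun y => 4 ^ k * (y.choose k : ℚ)

/-- Integral combinations of the functions `scaledChoose k`. -/
def scaledSpan : AddSubgroup (ℕ → ℚ) := AddSubgroup.closure (Set.range scaledChoose)

theorem scaledChoose_mem (k : ℕ) : scaledChoose k ∈ scaledSpan :=
  AddSubgroup.subset_closure ⟨k, rfl⟩

theorem choose_mul_choose_eq_sum (y p q : ℕ) :
    y.choose p * y.choose q =
      ∑ r ∈ Finset.range (q + 1),
        (p + q - r).choose p * p.choose r * y.choose (p + q - r) := by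
  rcases lt_or_ge y p with h | h
  · rw [Nat.choose_eq_zero_of_lt h, zero_mul, eq_comm]
    refine Finset.sum_eq_zero fun r hr => ?_
    rw [Finset.mem_range] at hr
    rw [Nat.choose_eq_zero_of_lt (by omega : y < p + q - r), mul_zero]
  · obtain ⟨d, rfl⟩ := Nat.exists_eq_add_of_le h
    rw [Nat.add_choose_eq p d q, Finset.Nat.sum_antidiagonal_eq_sum_range_succ_mk, Finset.mul_sum]
    refine Finset.sum_congr rfl fun r hr => ?_
    rw [Finset.mem_range] at hr
    have := Nat.choose_mul (n := p + d) (k := p + q - r) (s := p) (by omega)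
    rw [show p + d - p = d by omega, show p + q - r - p = q - r by omega] at this
    linear_combination (p.choose r) * this.symm

theorem scaledChoose_mul (p q : ℕ) :
    scaledChoose p * scaledChoose q =
      ∑ r ∈ Finset.range (q + 1),
        (4 ^ r * ((p + q - r).choose p * p.choose r)) • scaledChoose (p + q - r) := by
  ext y
  have h := congrArg (Nat.cast : ℕ → ℚ) (choose_mul_choose_eq_sum y p q)
  push_cast at h
  simp only [Pi.mul_apply, Finset.sum_apply, nsmul_eq_mul, Pi.natCast_apply, scaledChoose]
  rw [show (4 : ℚ) ^ p * (y.choose p) * (4 ^ q * (y.choose q))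
    = 4 ^ (p + q) * (y.choose p * y.choose q) by ring, h, Finset.mul_sum]
  refine Finset.sum_congr rfl fun r hr => ?_
  rw [Finset.mem_range] at hr
  rw [show p + q = r + (p + q - r) by omega, pow_add]
  rw [show r + (p + q - r) - r = p + q - r by omega]
  push_cast
  ring

theorem scaledSpan_mul_mem {f g : ℕ → ℚ} (hf : f ∈ scaledSpan) (hg : g ∈ scaledSpan) :
    f * g ∈ scaledSpan := by
  induction hf using AddSubgroup.closure_induction with
  | mem f hf =>
    obtain ⟨p, rfl⟩ := hf
    induction hg using AddSubgroup.closure_induction with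
    | mem g hg =>
      obtain ⟨q, rfl⟩ := hg
      rw [scaledChoose_mul]
      exact sum_mem fun r _ => nsmul_mem (scaledChoose_mem _) _
    | zero => simp
    | add g g' _ _ h h' => rw [mul_add]; exact add_mem h h'
    | neg g _ h => rw [mul_neg]; exact neg_mem h
  | zero => simp
  | add f f' _ _ h h' => rw [add_mul]; exact add_mem h h'
  | neg f _ h => rw [neg_mul]; exact neg_mem h

theorem one_mem_scaledSpan : (1 : ℕ → ℚ) ∈ scaledSpan := by
  convert scaledChoose_mem 0
  ext y
  simp [scaledChoose]

theorem scaledSpan_pow_mem {f : ℕ → ℚ} (hf : f ∈ scaledSpan) (c : ℕ) : f ^ c ∈ scaledSpan := by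
  induction c with
  | zero => simpa using one_mem_scaledSpan
  | succ c ih => rw [pow_succ]; exact scaledSpan_mul_mem ih hf

theorem exists_int_of_mem_scaledSpan {f : ℕ → ℚ} (hf : f ∈ scaledSpan) (y : ℕ) :
    ∃ t : ℤ, f y = t := by
  induction hf using AddSubgroup.closure_induction with
  | mem f hf =>
    obtain ⟨p, rfl⟩ := hf
    exact ⟨4 ^ p * y.choose p, by simp [scaledChoose]⟩
  | zero => exact ⟨0, by simp⟩
  | add f f' _ _ h h' =>
    obtain ⟨t, ht⟩ := h
    obtain ⟨t', ht'⟩ := h'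
    exact ⟨t + t', by simp [ht, ht']⟩
  | neg f _ h =>
    obtain ⟨t, ht⟩ := h
    exact ⟨-t, by simp [ht]⟩

theorem scaledChoose_sq (k : ℕ) :
    ∃ g ∈ scaledSpan,
      scaledChoose k ^ 2 = (2 * k).choose k • scaledChoose (2 * k) + 4 • g := by
  refine ⟨∑ r ∈ Finset.range k, (4 ^ r * ((2 * k - (r + 1)).choose k * k.choose (r + 1))) •
    scaledChoose (2 * k - (r + 1)), sum_mem fun r _ => nsmul_mem (scaledChoose_mem _) _, ?_⟩
  rw [sq, scaledChoose_mul, Finset.sum_range_succ', add_comm, Finset.smul_sum]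
  congr 1
  · simp [two_mul]
  · refine Finset.sum_congr rfl fun r _ => ?_
    rw [smul_smul, ← two_mul, pow_succ']
    ring_nf

theorem scaledSpan_sq {f : ℕ → ℚ} (hf : f ∈ scaledSpan) :
    ∃ t : ℤ, ∃ g ∈ scaledSpan, ∀ y, f y ^ 2 = t + 2 * g y := by
  induction hf using AddSubgroup.closure_induction with
  | mem f hf =>
    obtain ⟨k, rfl⟩ := hf
    rcases Nat.eq_zero_or_pos k with rfl | hk
    · exact ⟨1, 0, zero_mem _, fun y => by simp [scaledChoose]⟩
    · obtain ⟨g, hg, h⟩ := scaledChoose_sq k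
      obtain ⟨u, hu⟩ : 2 ∣ (2 * k).choose k := Nat.two_dvd_centralBinom_of_one_le hk
      refine ⟨0, u • scaledChoose (2 * k) + 2 • g,
        add_mem (nsmul_mem (scaledChoose_mem _) _) (nsmul_mem hg _), fun y => ?_⟩
      have := congrFun h y
      rw [hu] at this
      simp only [Pi.pow_apply, Pi.add_apply, Pi.mul_apply, nsmul_eq_mul, Pi.natCast_apply] at this ⊢
      rw [this]
      push_cast
      ring
  | zero => exact ⟨0, 0, zero_mem _, fun y => by simp⟩
  | add f f' hf hf' h h' =>
    obtain ⟨t, g, hg, h⟩ := h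
    obtain ⟨t', g', hg', h'⟩ := h'
    refine ⟨t + t', g + g' + f * f', add_mem (add_mem hg hg') (scaledSpan_mul_mem hf hf'),
      fun y => ?_⟩
    simp only [Pi.add_apply, Pi.mul_apply]
    push_cast
    linear_combination h y + h' y
  | neg f _ h =>
    obtain ⟨t, g, hg, h⟩ := h
    exact ⟨t, g, hg, fun y => by simpa using h y⟩

theorem odd_pow_two_pow_eq (n : ℕ) :
    ∃ o ∈ scaledSpan, ∃ t : ℤ, ∀ y : ℕ,
      (2 * y + 1 : ℚ) ^ 2 ^ n = o y + t / 2 * scaledChoose (2 ^ n) y := by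
  induction n with
  | zero => exact ⟨1, one_mem_scaledSpan, 1, fun y => by simp [scaledChoose]; ring⟩
  | succ n ih =>
    obtain ⟨o, ho, t, h⟩ := ih
    obtain ⟨g, hg, hE⟩ := scaledChoose_sq (2 ^ n)
    obtain ⟨u, hu⟩ : 2 ∣ (2 * 2 ^ n).choose (2 ^ n) :=
      Nat.two_dvd_centralBinom_of_one_le Nat.one_le_two_pow
    refine ⟨o * o + t • (o * scaledChoose (2 ^ n)) + t ^ 2 • g,
      add_mem (add_mem (scaledSpan_mul_mem ho ho)
        (zsmul_mem (scaledSpan_mul_mem ho (scaledChoose_mem _)) _)) (zsmul_mem hg _),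
      t ^ 2 * u, fun y => ?_⟩
    have hy := congrFun hE y
    rw [hu] at hy
    simp only [Pi.pow_apply, Pi.add_apply, nsmul_eq_mul, Pi.mul_apply, zsmul_eq_mul,
      Pi.natCast_apply, Pi.intCast_apply] at hy ⊢
    rw [pow_succ' 2 n, pow_mul', h]
    push_cast at hy ⊢
    linear_combination (t ^ 2 / 4 : ℚ) * hy

theorem odd_pow_agree (n c : ℕ) :
    ∃ o ∈ scaledSpan, ∀ y : ℕ, y < 2 ^ n → (2 * y + 1 : ℚ) ^ (c * 2 ^ n) = o y := by
  obtain ⟨o, ho, t, h⟩ := odd_pow_two_pow_eq n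
  refine ⟨o ^ c, scaledSpan_pow_mem ho c, fun y hy => ?_⟩
  rw [pow_mul', h, Pi.pow_apply, scaledChoose, Nat.choose_eq_zero_of_lt hy]
  simp

theorem odd_pow_agree_one_add (n c : ℕ) :
    ∃ o ∈ scaledSpan, ∀ y : ℕ, y < 2 ^ n → (2 * y + 1 : ℚ) ^ (c * 2 ^ (n + 1)) = 1 + 2 * o y := by
  obtain ⟨f, hf, h⟩ := odd_pow_agree n 1
  obtain ⟨t, g, hg, hs⟩ := scaledSpan_sq hf
  have h0 : (1 : ℚ) = t + 2 * g 0 := by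
    rw [← hs, ← h 0 (by positivity)]
    simp
  obtain ⟨z, hz⟩ := exists_int_of_mem_scaledSpan hg 0
  have hy : ∀ y : ℕ, y < 2 ^ n → (2 * y + 1 : ℚ) ^ (2 ^ (n + 1)) = 1 + 2 * (g - z • 1) y := by
    intro y hy
    have := h y hy
    rw [one_mul] at this
    rw [pow_succ, pow_mul, this, hs]
    simp only [Pi.sub_apply, zsmul_eq_mul, Pi.mul_apply, Pi.one_apply, Pi.intCast_apply]
    linear_combination -h0 - 2 * hz
  have hg' : g - z • 1 ∈ scaledSpan := sub_mem hg (zsmul_mem one_mem_scaledSpan _)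
  induction c with
  | zero => exact ⟨0, zero_mem _, fun y _ => by simp⟩
  | succ c ih =>
    obtain ⟨o, ho, h⟩ := ih
    refine ⟨o + (g - z • 1) + 2 • (o * (g - z • 1)),
      add_mem (add_mem ho hg') (nsmul_mem (scaledSpan_mul_mem ho hg') _), fun y hyn => ?_⟩
    rw [add_mul, pow_add, h y hyn, one_mul, hy y hyn]
    simp only [Pi.add_apply, Pi.mul_apply, nsmul_eq_mul, Pi.natCast_apply]
    push_cast
    ring

theorem odd_pow_agree_add {n c : ℕ} (hc : Odd c) :
    ∃ o ∈ scaledSpan, ∀ y : ℕ, y < 2 ^ n →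
      (2 * y + 1 : ℚ) ^ (c * 2 ^ n) = (2 * y + 1 : ℚ) ^ 2 ^ n + 2 * o y := by
  obtain ⟨d, rfl⟩ := hc
  obtain ⟨f, hf, h⟩ := odd_pow_agree n 1
  obtain ⟨g, hg, h'⟩ := odd_pow_agree_one_add n d
  refine ⟨f * g, scaledSpan_mul_mem hf hg, fun y hy => ?_⟩
  have := h y hy
  rw [one_mul] at this
  rw [show (2 * d + 1) * 2 ^ n = 2 ^ n + d * 2 ^ (n + 1) by ring, pow_add, h' y hy, this,
    Pi.mul_apply]
  ring

theorem sum_choose_odd_mul_choose (M k a : ℕ) (ha : a + 1 ≤ 2 * M) :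
    4 ^ k * ∑ y ∈ Finset.range M, (a + 1).choose (2 * y + 1) * y.choose k =
      2 ^ a * (a - k).choose k := by
  induction a using Nat.twoStepInduction generalizing k with
  | zero =>
    obtain ⟨M, rfl⟩ : ∃ m, M = m + 1 := ⟨M - 1, by omega⟩
    rw [Finset.sum_range_succ']
    have : ∀ y, (0 + 1).choose (2 * (y + 1) + 1) = 0 := fun y =>
      Nat.choose_eq_zero_of_lt (by omega)
    cases k <;> simp [this]
  | one =>
    obtain ⟨M, rfl⟩ : ∃ m, M = m + 1 := ⟨M - 1, by omega⟩
    rw [Finset.sum_range_succ']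
    have : ∀ y, (1 + 1).choose (2 * (y + 1) + 1) = 0 := fun y =>
      Nat.choose_eq_zero_of_lt (by omega)
    rcases k with _ | k
    · simp [this]
    · simp [this]
  | more a ih1 ih2 =>
    obtain ⟨M, rfl⟩ : ∃ m, M = m + 1 := ⟨M - 1, by omega⟩
    have hodd : ∀ k, ∑ y ∈ Finset.range (M + 1), (a + 2 + 1).choose (2 * y + 1) * y.choose k =
        ∑ y ∈ Finset.range (M + 1), (a + 1 + 1).choose (2 * y) * y.choose k +
        ∑ y ∈ Finset.range (M + 1), (a + 1 + 1).choose (2 * y + 1) * y.choose k := fun k => by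
      rw [← Finset.sum_add_distrib]
      exact Finset.sum_congr rfl fun y _ => by rw [Nat.choose_succ_succ]; ring
    have hodd' : ∀ k, ∑ y ∈ Finset.range (M + 1), (a + 1 + 1).choose (2 * y + 1) * y.choose k =
        ∑ y ∈ Finset.range (M + 1), (a + 1).choose (2 * y) * y.choose k +
        ∑ y ∈ Finset.range (M + 1), (a + 1).choose (2 * y + 1) * y.choose k := fun k => by
      rw [← Finset.sum_add_distrib]
      exact Finset.sum_congr rfl fun y _ => by rw [Nat.choose_succ_succ]; ring
    have heven : ∀ k, ∑ y ∈ Finset.range (M + 1), (a + 1 + 1).choose (2 * y) * y.choose k =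
        ∑ y ∈ Finset.range (M + 1), (a + 1).choose (2 * y) * y.choose k +
        ∑ y ∈ Finset.range M, (a + 1).choose (2 * y + 1) * (y + 1).choose k := fun k => by
      have hs : ∑ y ∈ Finset.range M, (a + 1 + 1).choose (2 * (y + 1)) * (y + 1).choose k =
          ∑ y ∈ Finset.range M, (a + 1).choose (2 * (y + 1)) * (y + 1).choose k +
          ∑ y ∈ Finset.range M, (a + 1).choose (2 * y + 1) * (y + 1).choose k := by
        rw [← Finset.sum_add_distrib]
        refine Finset.sum_congr rfl fun y _ => ?_
        rw [show 2 * (y + 1) = 2 * y + 1 + 1 by ring, Nat.choose_succ_succ (a + 1)]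
        ring
      rw [Finset.sum_range_succ', Finset.sum_range_succ', hs, add_right_comm]
      simp
    have hlast : ∀ k, ∑ y ∈ Finset.range M, (a + 1).choose (2 * y + 1) * y.choose k =
        ∑ y ∈ Finset.range (M + 1), (a + 1).choose (2 * y + 1) * y.choose k := fun k => by
      rw [Finset.sum_range_succ, Nat.choose_eq_zero_of_lt (by omega : a + 1 < 2 * M + 1)]
      simp
    rcases k with _ | k
    · have h1 := ih1 0 (by omega)
      have h2 := ih2 0 (by omega)
      have he := heven 0
      have hl := hlast 0
      rw [hodd 0, he]
      rw [hodd'] at h2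
      have h3 := hodd' 0
      simp only [Nat.choose_zero_right, pow_zero, one_mul, mul_one] at hl h1 h2 h3 ⊢
      rw [hl, h3]
      rw [pow_succ] at h2 ⊢
      omega
    · have h1 := ih1 (k + 1) (by omega)
      have h1' := ih1 k (by omega)
      have h2 := ih2 (k + 1) (by omega)
      have he := heven (k + 1)
      have hs : ∑ y ∈ Finset.range M, (a + 1).choose (2 * y + 1) * (y + 1).choose (k + 1) =
        ∑ y ∈ Finset.range M, (a + 1).choose (2 * y + 1) * y.choose k +
        ∑ y ∈ Finset.range M, (a + 1).choose (2 * y + 1) * y.choose (k + 1) := by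
        rw [← Finset.sum_add_distrib]
        exact Finset.sum_congr rfl fun y _ => by rw [Nat.choose_succ_succ y]; ring
      rw [hs, hlast, hlast] at he
      rw [hodd, he]
      have hp : (a + 2 - (k + 1)).choose (k + 1) =
          (a - k).choose k + (a + 1 - (k + 1)).choose (k + 1) := by
        rcases le_or_gt k a with hk | hk
        · rw [show a + 2 - (k + 1) = (a - k) + 1 by omega, show a + 1 - (k + 1) = a - k by omega,
            Nat.choose_succ_succ]
        · rw [Nat.choose_eq_zero_of_lt (by omega), Nat.choose_eq_zero_of_lt (by omega),
            Nat.choose_eq_zero_of_lt (by omega)]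
      rw [hp]
      have h3 := hodd' (k + 1)
      rw [h3] at h2 ⊢
      zify at h1' h2 ⊢
      linear_combination 4 * h1' + 2 * h2

theorem S_eq_zero_of_lt {N k : ℕ} (h : N < k) : S N k = 0 := by
  induction N generalizing k with
  | zero =>
    obtain ⟨k, rfl⟩ := Nat.exists_eq_succ_of_ne_zero h.ne'
    rfl
  | succ N ih =>
    obtain ⟨k, rfl⟩ := Nat.exists_eq_succ_of_ne_zero (Nat.ne_zero_of_lt h)
    rw [Nat.succ_eq_add_one, S, ih (by omega), ih (by omega), mul_zero, add_zero]

theorem S_zero_right {N : ℕ} (h : N ≠ 0) : S N 0 = 0 := by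
  obtain ⟨N, rfl⟩ := Nat.exists_eq_succ_of_ne_zero h
  rfl

theorem sum_alternating_choose_mul_pow (N a m : ℕ) (h : a < m) :
    ∑ i ∈ Finset.range m, (-1 : ℤ) ^ i * a.choose i * (i : ℤ) ^ N =
      (-1) ^ a * a.factorial * S N a := by
  induction N generalizing a with
  | zero =>
    obtain ⟨d, rfl⟩ := Nat.exists_eq_add_of_le (Nat.succ_le_of_lt h)
    have hz : ∑ x ∈ Finset.range d, (-1 : ℤ) ^ (a + 1 + x) * a.choose (a + 1 + x) = 0 :=
      Finset.sum_eq_zero fun x _ => by rw [Nat.choose_eq_zero_of_lt (by omega)]; simp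
    simp only [pow_zero, mul_one, Nat.succ_eq_add_one]
    rw [Finset.sum_range_add, Int.alternating_sum_range_choose, hz]
    cases a <;> simp [S]
  | succ N ih =>
    rcases a with _ | a
    · rw [Finset.sum_eq_zero]
      · simp [S]
      · intro i _
        cases i <;> simp
    · have key : ∀ i : ℕ, (i : ℤ) * (a + 1).choose i =
          (a + 1) * ((a + 1).choose i - a.choose i) := by
        intro i
        rcases i with _ | i
        · simp
        · have h1 := Nat.add_one_mul_choose_eq a i
          have h2 := Nat.choose_succ_succ a i
          zify at h1 h2
          push_cast
          linear_combination (-1 : ℤ) * h1 - (a + 1 : ℤ) * h2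
      have hs : ∑ i ∈ Finset.range m, (-1 : ℤ) ^ i * (a + 1).choose i * (i : ℤ) ^ (N + 1) =
          (a + 1) * (∑ i ∈ Finset.range m, (-1 : ℤ) ^ i * (a + 1).choose i * (i : ℤ) ^ N -
            ∑ i ∈ Finset.range m, (-1 : ℤ) ^ i * a.choose i * (i : ℤ) ^ N) := by
        rw [← Finset.sum_sub_distrib, Finset.mul_sum]
        refine Finset.sum_congr rfl fun i _ => ?_
        linear_combination ((-1 : ℤ) ^ i * (i : ℤ) ^ N) * key i
      rw [hs, ih _ h, ih _ (by omega), S, Nat.factorial_succ]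
      push_cast
      ring

theorem pow_eq_sum_S (N y : ℕ) :
    y ^ N = ∑ k ∈ Finset.range (N + 1), S N k * k.factorial * y.choose k := by
  induction N with
  | zero => simp [S]
  | succ N ih =>
    have key : ∀ k, y * (k.factorial * y.choose k) =
        (k + 1).factorial * y.choose (k + 1) + k * (k.factorial * y.choose k) := by
      intro k
      rcases lt_or_ge y k with h | h
      · simp [Nat.choose_eq_zero_of_lt h, Nat.choose_eq_zero_of_lt (h.trans (Nat.lt_succ_self k))]
      · have h1 := Nat.choose_succ_right_eq y k
        zify [h] at h1 ⊢
        rw [Nat.factorial_succ]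
        push_cast
        linear_combination (-(k.factorial : ℤ)) * h1
    have hmul : y * ∑ k ∈ Finset.range (N + 1), S N k * k.factorial * y.choose k =
        ∑ k ∈ Finset.range (N + 1), S N k * ((k + 1).factorial * y.choose (k + 1)) +
        ∑ k ∈ Finset.range (N + 1), k * (S N k * (k.factorial * y.choose k)) := by
      rw [← Finset.sum_add_distrib, Finset.mul_sum]
      refine Finset.sum_congr rfl fun k _ => ?_
      linear_combination (S N k) * key k
    have hshift : ∑ k ∈ Finset.range (N + 1), k * (S N k * (k.factorial * y.choose k)) =
        ∑ k ∈ Finset.range (N + 1),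
          (k + 1) * (S N (k + 1) * ((k + 1).factorial * y.choose (k + 1))) := by
      rw [Finset.sum_range_succ', Finset.sum_range_succ, S_eq_zero_of_lt (Nat.lt_succ_self N)]
      simp
    rw [pow_succ', ih, hmul, hshift, ← Finset.sum_add_distrib, Finset.sum_range_succ' _ (N + 1),
      S_zero_right N.succ_ne_zero, zero_mul, zero_mul, add_zero]
    refine Finset.sum_congr rfl fun k _ => ?_
    rw [S]
    ring

theorem sum_range_two_mul {β : Type*} [AddCommMonoid β] (f : ℕ → β) (M : ℕ) :
    ∑ i ∈ Finset.range (2 * M), f i =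
      ∑ y ∈ Finset.range M, f (2 * y) + ∑ y ∈ Finset.range M, f (2 * y + 1) := by
  induction M with
  | zero => simp
  | succ M ih =>
    rw [Nat.mul_succ, Finset.sum_range_succ, Finset.sum_range_succ, ih, Finset.sum_range_succ,
      Finset.sum_range_succ]
    abel

theorem factorial_mul_S_eq (N a M : ℕ) (h : a < 2 * M) :
    (-1 : ℤ) ^ a * a.factorial * S N a =
      ∑ y ∈ Finset.range M, (a.choose (2 * y) : ℤ) * (2 * y) ^ N -
      ∑ y ∈ Finset.range M, (a.choose (2 * y + 1) : ℤ) * (2 * y + 1) ^ N := by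
  rw [← sum_alternating_choose_mul_pow N a _ h, sum_range_two_mul, sub_eq_add_neg,
    ← Finset.sum_neg_distrib]
  congr 1 <;> refine Finset.sum_congr rfl fun y _ => ?_ <;> push_cast [pow_succ, pow_mul] <;> simp

theorem sum_choose_odd_mul_of_mem {o : ℕ → ℚ} (ho : o ∈ scaledSpan) {a M : ℕ}
    (h : a + 1 ≤ 2 * M) :
    ∃ z : ℤ, ∑ y ∈ Finset.range M, ((a + 1).choose (2 * y + 1) : ℚ) * o y = 2 ^ a * z := by
  induction ho using AddSubgroup.closure_induction with
  | mem f hf =>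
    obtain ⟨k, rfl⟩ := hf
    refine ⟨(a - k).choose k, ?_⟩
    have := congrArg (Nat.cast : ℕ → ℚ) (sum_choose_odd_mul_choose M k a h)
    push_cast at this ⊢
    rw [← this, Finset.mul_sum]
    refine Finset.sum_congr rfl fun y _ => ?_
    rw [scaledChoose]
    ring
  | zero => exact ⟨0, by simp⟩
  | add f g _ _ hf hg =>
    obtain ⟨z, hz⟩ := hf
    obtain ⟨w, hw⟩ := hg
    refine ⟨z + w, ?_⟩
    simp only [Pi.add_apply, mul_add, Finset.sum_add_distrib]
    rw [hz, hw]
    push_cast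
    ring
  | neg f _ hf =>
    obtain ⟨z, hz⟩ := hf
    refine ⟨-z, ?_⟩
    simp only [Pi.neg_apply, mul_neg, Finset.sum_neg_distrib]
    rw [hz]
    push_cast
    ring

theorem sum_choose_odd (a M : ℕ) (h : a + 1 ≤ 2 * M) :
    ∑ y ∈ Finset.range M, (a + 1).choose (2 * y + 1) = 2 ^ a := by
  simpa using sum_choose_odd_mul_choose M 0 a h

theorem exists_odd_sum_eq {n c a M : ℕ} (h : a + 1 ≤ 2 * M) (hM : M ≤ 2 ^ n) :
    ∃ z : ℤ, ∑ y ∈ Finset.range M, ((a + 1).choose (2 * y + 1) : ℤ) * (2 * y + 1) ^ (c * 2 ^ n) =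
      2 ^ a * z := by
  obtain ⟨o, ho, hf⟩ := odd_pow_agree n c
  obtain ⟨z, hz⟩ := sum_choose_odd_mul_of_mem ho h
  refine ⟨z, ?_⟩
  qify
  rw [← hz]
  refine Finset.sum_congr rfl fun y hy => ?_
  rw [hf y ((Finset.mem_range.1 hy).trans_le hM)]

theorem exists_odd_sum_eq_one_add {n c a M : ℕ} (h : a + 1 ≤ 2 * M) (hM : M ≤ 2 ^ n) :
    ∃ z : ℤ, ∑ y ∈ Finset.range M,
      ((a + 1).choose (2 * y + 1) : ℤ) * (2 * y + 1) ^ (c * 2 ^ (n + 1)) = 2 ^ a * (1 + 2 * z) := by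
  obtain ⟨o, ho, hf⟩ := odd_pow_agree_one_add n c
  obtain ⟨z, hz⟩ := sum_choose_odd_mul_of_mem ho h
  refine ⟨z, ?_⟩
  qify
  have h1 := congrArg (Nat.cast : ℕ → ℚ) (sum_choose_odd a M h)
  push_cast at h1
  rw [mul_add, mul_one, ← mul_left_comm, ← hz, ← h1, Finset.mul_sum, ← Finset.sum_add_distrib]
  refine Finset.sum_congr rfl fun y hy => ?_
  rw [hf y ((Finset.mem_range.1 hy).trans_le hM)]
  ring

theorem exists_odd_sum_eq_add {n c a M : ℕ} (hc : Odd c) (h : a + 1 ≤ 2 * M) (hM : M ≤ 2 ^ n) :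
    ∃ z : ℤ, ∑ y ∈ Finset.range M, ((a + 1).choose (2 * y + 1) : ℤ) * (2 * y + 1) ^ (c * 2 ^ n) =
      ∑ y ∈ Finset.range M, ((a + 1).choose (2 * y + 1) : ℤ) * (2 * y + 1) ^ 2 ^ n +
        2 ^ (a + 1) * z := by
  obtain ⟨o, ho, hf⟩ := odd_pow_agree_add (n := n) hc
  obtain ⟨z, hz⟩ := sum_choose_odd_mul_of_mem ho h
  refine ⟨z, ?_⟩
  qify
  rw [pow_succ', mul_assoc, ← hz, Finset.mul_sum, ← Finset.sum_add_distrib]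
  refine Finset.sum_congr rfl fun y hy => ?_
  rw [hf y ((Finset.mem_range.1 hy).trans_le hM)]
  ring

theorem two_pow_dvd_factorial_mul_S_add {N a M : ℕ} (hN : a ≤ N) (h : a ≤ 2 * M) :
    (2 : ℤ) ^ a ∣ (-1) ^ a * a.factorial * S N a +
      ∑ y ∈ Finset.range M, (a.choose (2 * y + 1) : ℤ) * (2 * y + 1) ^ N := by
  have hz : ∑ x ∈ Finset.range (a + 1),
      (a.choose (2 * (M + x) + 1) : ℤ) * (2 * ((M + x : ℕ) : ℤ) + 1) ^ N = 0 :=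
    Finset.sum_eq_zero fun x _ => by rw [Nat.choose_eq_zero_of_lt (by omega)]; simp
  rw [factorial_mul_S_eq N a (M + (a + 1)) (by omega), Finset.sum_range_add _ M (a + 1),
    Finset.sum_range_add _ M (a + 1), hz, add_zero, sub_add_cancel, ← Finset.sum_range_add]
  refine Finset.dvd_sum fun y _ => Dvd.dvd.mul_left ?_ _
  rw [mul_pow]
  exact (pow_dvd_pow 2 hN).mul_right _

theorem factorial_mul_two_pow_s₂ (a : ℕ) : ∃ q, Odd q ∧ a.factorial * 2 ^ s₂ a = 2 ^ a * q := by
  have hl := sub_one_mul_padicValNat_factorial (p := 2) a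
  have hle := Nat.digit_sum_le 2 a
  obtain ⟨q, hq⟩ := pow_padicValNat_dvd (p := 2) (n := a.factorial)
  have hq' : Odd q := by
    rw [← Nat.not_even_iff_odd, even_iff_two_dvd]
    rintro ⟨r, rfl⟩
    refine pow_succ_padicValNat_not_dvd (p := 2) (Nat.factorial_ne_zero a) ⟨r, ?_⟩
    rw [pow_succ, mul_assoc]
    exact hq
  refine ⟨q, hq', ?_⟩
  have he : padicValNat 2 a.factorial + s₂ a = a := by
    rw [s₂]
    omega
  conv_lhs => rw [hq]
  conv_rhs => rw [← he]
  ring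

theorem two_pow_s₂_dvd_of_dvd {a : ℕ} {X : ℤ} (h : (2 : ℤ) ^ a ∣ a.factorial * X) :
    (2 : ℤ) ^ s₂ a ∣ X := by
  obtain ⟨q, hq, e⟩ := factorial_mul_two_pow_s₂ a
  have hq' : IsCoprime ((2 : ℤ) ^ s₂ a) q := by
    obtain ⟨u, rfl⟩ := hq
    exact IsCoprime.pow_left ⟨-u, 1, by push_cast; ring⟩
  refine hq'.dvd_of_dvd_mul_left ?_
  refine (mul_dvd_mul_iff_left (pow_ne_zero a two_ne_zero)).1 ?_
  zify at e
  rw [← mul_assoc, ← e, mul_right_comm]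
  exact mul_dvd_mul_right h _

theorem two_pow_succ_s₂_dvd_of_dvd {a : ℕ} {X σ : ℤ}
    (h : (2 : ℤ) ^ (a + 1) ∣ 2 * ((-1) ^ a * a.factorial * X) + 2 ^ a * σ) :
    (2 : ℤ) ^ (s₂ a + 1) ∣ 2 * X - 2 ^ s₂ a * σ := by
  obtain ⟨q, hq, e⟩ := factorial_mul_two_pow_s₂ a
  obtain ⟨u, hu⟩ : Odd ((-1) ^ a * (q : ℤ)) := by
    refine Odd.mul (Odd.pow (by decide)) (by exact_mod_cast hq)
  have hq' : IsCoprime ((2 : ℤ) ^ (s₂ a + 1)) ((-1) ^ a * q) := by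
    rw [hu]
    exact IsCoprime.pow_left ⟨-u, 1, by ring⟩
  refine hq'.dvd_of_dvd_mul_left ?_
  refine (mul_dvd_mul_iff_left (pow_ne_zero a two_ne_zero)).1 ?_
  obtain ⟨v, hv⟩ := h
  zify at e
  refine ⟨v - (u + 1) * σ, ?_⟩
  simp only [pow_succ] at *
  linear_combination (2 : ℤ) ^ s₂ a * hv - 2 * (-1) ^ a * X * e - (2 : ℤ) ^ a * 2 ^ s₂ a * σ * hu

theorem two_pow_s₂_dvd_of_lt {n c a : ℕ} (ha : a < 2 ^ (n + 1)) :
    (2 : ℤ) ^ s₂ a ∣ 2 * S (c * 2 ^ n) a := by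
  rcases a with _ | a
  · simp [s₂]
  rcases lt_or_ge (c * 2 ^ n) (a + 1) with h | h
  · simp [S_eq_zero_of_lt h]
  rw [pow_succ'] at ha
  obtain ⟨z, hz⟩ := exists_odd_sum_eq (n := n) (c := c) ha.le le_rfl
  have h1 := two_pow_dvd_factorial_mul_S_add h ha.le
  rw [hz] at h1
  refine two_pow_s₂_dvd_of_dvd ?_
  obtain ⟨v, hv⟩ := h1
  refine ⟨(-1) ^ (a + 1) * (2 * v - z), ?_⟩
  have hsq : ((-1 : ℤ) ^ (a + 1)) * (-1) ^ (a + 1) = 1 := by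
    rw [← mul_pow]
    simp
  simp only [pow_succ (2 : ℤ)] at *
  linear_combination 2 * (-1) ^ (a + 1) * hv -
    (2 * (a + 1).factorial * S (c * 2 ^ n) (a + 1) : ℤ) * hsq

theorem two_pow_succ_s₂_dvd_of_le {n c a : ℕ} (hc : 0 < c) (ha0 : 0 < a) (ha : a ≤ 2 ^ (n + 1)) :
    (2 : ℤ) ^ (s₂ a + 1) ∣ 2 * S (c * 2 ^ (n + 1)) a - 2 ^ s₂ a := by
  obtain ⟨a, rfl⟩ := Nat.exists_eq_succ_of_ne_zero ha0.ne'
  have hN : a + 1 ≤ c * 2 ^ (n + 1) := ha.trans (Nat.le_mul_of_pos_left _ hc)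
  rw [pow_succ'] at ha
  obtain ⟨z, hz⟩ := exists_odd_sum_eq_one_add (n := n) (c := c) ha le_rfl
  obtain ⟨v, hv⟩ := two_pow_dvd_factorial_mul_S_add hN ha
  rw [hz] at hv
  have := two_pow_succ_s₂_dvd_of_dvd (a := a + 1) (X := S (c * 2 ^ (n + 1)) (a + 1)) (σ := 1)
    ⟨v - z, by simp only [pow_succ (2 : ℤ)] at *; linear_combination 2 * hv⟩
  rwa [mul_one] at this

theorem sum_choose_even_mul_choose {M k a : ℕ} (h : a + 2 ≤ 2 * M) :
    (4 : ℤ) ^ k * ∑ y ∈ Finset.range M, ((a + 1).choose (2 * y) : ℤ) * y.choose k =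
      2 ^ a * (2 * (a + 1 - k).choose k - (a - k).choose k) := by
  have h1 := sum_choose_odd_mul_choose M k a (by omega)
  have h2 := sum_choose_odd_mul_choose M k (a + 1) h
  have h3 : ∑ y ∈ Finset.range M, (a + 1 + 1).choose (2 * y + 1) * y.choose k =
      ∑ y ∈ Finset.range M, (a + 1).choose (2 * y) * y.choose k +
      ∑ y ∈ Finset.range M, (a + 1).choose (2 * y + 1) * y.choose k := by
    rw [← Finset.sum_add_distrib]
    exact Finset.sum_congr rfl fun y _ => by rw [Nat.choose_succ_succ]; ring
  rw [h3] at h2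
  zify at h1 h2
  rw [pow_succ] at h2
  linear_combination h2 - h1

theorem exists_odd_two_mul_factorial_mul_S {n k : ℕ} (hk : 0 < k) (hk' : k ≤ 2 ^ (n + 1)) :
    ∃ w : ℤ, Odd w ∧ 2 * (S (2 ^ (n + 1)) k * k.factorial : ℤ) = 2 ^ k * w := by
  have h := two_pow_succ_s₂_dvd_of_le (n := n) (c := 1) one_pos hk hk'
  rw [one_mul] at h
  obtain ⟨v, hv⟩ := h
  obtain ⟨q, hq, e⟩ := factorial_mul_two_pow_s₂ k
  refine ⟨q * (2 * v + 1), Odd.mul (by exact_mod_cast hq) ⟨v, rfl⟩, ?_⟩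
  zify at e
  rw [pow_succ (2 : ℤ)] at hv
  linear_combination (k.factorial : ℤ) * hv + (2 * v + 1) * e

theorem even_sum_congr {n a : ℕ} (h1 : 2 ^ (n + 1) < a + 1) (h2 : a + 1 < 2 ^ (n + 2)) :
    (2 : ℤ) ^ (a + 2) ∣ 2 * ∑ y ∈ Finset.range (2 ^ (n + 1)),
      ((a + 1).choose (2 * y) : ℤ) * (2 * y) ^ 2 ^ (n + 1) -
        2 ^ (a + 1) * (if a + 1 = 2 ^ (n + 2) - 1 then 1 else 0) := by
  obtain ⟨P, hP⟩ : ∃ P, 2 ^ (n + 1) = P + 2 := ⟨2 ^ (n + 1) - 2, by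
    have := Nat.one_le_two_pow (n := n)
    rw [pow_succ]; omega⟩
  have hP' : 2 ^ (n + 2) = 2 * (P + 2) := by rw [← hP]; ring
  have hw := fun k (hk : 0 < k) (hk' : k ≤ P + 2) =>
    exists_odd_two_mul_factorial_mul_S (n := n) hk (hP ▸ hk')
  rw [hP] at h1 hw ⊢
  rw [hP'] at h2 ⊢
  have hexp : 2 * ∑ y ∈ Finset.range (P + 2), ((a + 1).choose (2 * y) : ℤ) * (2 * y) ^ (P + 2) =
      ∑ k ∈ Finset.range (P + 2 + 1), 2 * 2 ^ (P + 2) * ((S (P + 2) k * k.factorial : ℤ) *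
        ∑ y ∈ Finset.range (P + 2), ((a + 1).choose (2 * y) : ℤ) * y.choose k) := by
    simp only [Finset.mul_sum]
    rw [Finset.sum_comm]
    refine Finset.sum_congr rfl fun y _ => ?_
    have := pow_eq_sum_S (P + 2) y
    zify at this
    rw [mul_pow, this]
    simp only [Finset.mul_sum]
    exact Finset.sum_congr rfl fun k _ => by ring
  have hterm : ∀ k, 0 < k → k ≤ P + 2 → ∃ w : ℤ, Odd w ∧
      2 ^ (k + 1) * (2 * 2 ^ (P + 2) * ((S (P + 2) k * k.factorial : ℤ) *
        ∑ y ∈ Finset.range (P + 2), ((a + 1).choose (2 * y) : ℤ) * y.choose k)) =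
      2 ^ (P + 3 + a) * w * (2 * (a + 1 - k).choose k - (a - k).choose k) := by
    intro k hk hk'
    obtain ⟨w, hwo, hw⟩ := hw k hk hk'
    refine ⟨w, hwo, ?_⟩
    have he := sum_choose_even_mul_choose (M := P + 2) (k := k) (a := a) (by omega)
    refine mul_left_cancel₀ (pow_ne_zero k two_ne_zero) ?_
    have h4 : (4 : ℤ) ^ k = 2 ^ k * 2 ^ k := by rw [← mul_pow]; norm_num
    rw [h4] at he
    simp only [pow_succ, pow_add] at *
    linear_combination (2 ^ k * w * 2 * (2 ^ P * 2 * 2) : ℤ) * he +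
      2 * 2 ^ k * 2 ^ k * (2 ^ P * 2 * 2) *
        (∑ y ∈ Finset.range (P + 2), ((a + 1).choose (2 * y) : ℤ) * y.choose k) * hw
  rw [hexp, Finset.sum_range_succ, Finset.sum_range_succ, add_assoc, add_sub_assoc]
  refine dvd_add (Finset.dvd_sum fun k hk => ?_) ?_
  · rcases Nat.eq_zero_or_pos k with rfl | hk0
    · simp [S_zero_right]
    · rw [Finset.mem_range] at hk
      obtain ⟨w, -, hw⟩ := hterm k hk0 (by omega)
      refine (mul_dvd_mul_iff_left (pow_ne_zero (k + 1) two_ne_zero)).1 ?_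
      rw [hw, ← pow_add, mul_assoc]
      exact (pow_dvd_pow 2 (by omega)).mul_right _
  · obtain ⟨w, ⟨u, hu⟩, hw1⟩ := hterm (P + 1) (by omega) (by omega)
    obtain ⟨w', -, hw2⟩ := hterm (P + 2) (by omega) le_rfl
    rw [Nat.choose_eq_zero_of_lt (by omega : a + 1 - (P + 2) < P + 2),
      Nat.choose_eq_zero_of_lt (by omega : a - (P + 2) < P + 2), Nat.cast_zero, mul_zero, sub_zero,
      mul_zero] at hw2
    rw [(mul_eq_zero.1 hw2).resolve_left (by positivity), add_zero]
    rw [show P + 3 + a = P + 1 + 1 + (a + 1) by ring, pow_add _ (P + 1 + 1),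
      mul_assoc (2 ^ (P + 1 + 1) * 2 ^ (a + 1)) w, mul_assoc (2 ^ (P + 1 + 1)) (2 ^ (a + 1))] at hw1
    rw [mul_left_cancel₀ (pow_ne_zero (P + 1 + 1) two_ne_zero) hw1, ← mul_sub, pow_succ _ (a + 1)]
    refine mul_dvd_mul_left _ ?_
    split_ifs with h
    · rw [show a - (P + 1) = P + 1 by omega, Nat.choose_self, hu]
      exact ⟨(2 * u + 1) * (a + 1 - (P + 1)).choose (P + 1) - u - 1, by push_cast; ring⟩
    · rw [Nat.choose_eq_zero_of_lt (by omega : a - (P + 1) < P + 1)]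
      exact ⟨w * (a + 1 - (P + 1)).choose (P + 1), by push_cast; ring⟩

theorem two_pow_succ_s₂_dvd_of_gt {n c a : ℕ} (hc : Odd c) (hc' : 1 < c) (h1 : 2 ^ (n + 1) < a)
    (h2 : a < 2 ^ (n + 2)) :
    (2 : ℤ) ^ (s₂ a + 1) ∣ 2 * S (c * 2 ^ (n + 1)) a -
      2 ^ s₂ a * (if a = 2 ^ (n + 2) - 1 then 1 else 0) := by
  obtain ⟨a, rfl⟩ : ∃ d, a = d + 1 := Nat.exists_eq_succ_of_ne_zero (Nat.ne_zero_of_lt h1)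
  have hM : 2 ^ (n + 2) = 2 * 2 ^ (n + 1) := pow_succ' 2 (n + 1)
  have hN : a + 1 ≤ c * 2 ^ (n + 1) := by
    rw [hM] at h2
    exact h2.le.trans (Nat.mul_le_mul_right _ hc')
  obtain ⟨z, hz⟩ := exists_odd_sum_eq_add (n := n + 1) (a := a) hc (by omega) le_rfl
  obtain ⟨v, hv⟩ := two_pow_dvd_factorial_mul_S_add hN (by omega : a + 1 ≤ 2 * 2 ^ (n + 1))
  obtain ⟨w, hw⟩ := even_sum_congr h1 h2
  have h0 := factorial_mul_S_eq (2 ^ (n + 1)) (a + 1) (2 ^ (n + 1)) (by omega)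
  rw [S_eq_zero_of_lt h1] at h0
  rw [hz] at hv
  refine two_pow_succ_s₂_dvd_of_dvd ⟨v - z - w, ?_⟩
  rw [Nat.cast_zero, mul_zero] at h0
  rw [show a + 2 = a + 1 + 1 from rfl, pow_succ (2 : ℤ) (a + 1)] at hw
  rw [pow_succ (2 : ℤ) (a + 1)]
  linear_combination 2 * hv - 2 * h0 - hw


theorem dvd_prod_sub_prod {R : Type*} [CommRing R] {d : R} {f g : ℕ → R}
    (h : ∀ i, d ∣ f i - g i) (m : ℕ) :
    d ∣ ∏ i ∈ Finset.range m, f i - ∏ i ∈ Finset.range m, g i := by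
  induction m with
  | zero => simp
  | succ m ih =>
    rw [Finset.prod_range_succ, Finset.prod_range_succ]
    exact dvd_mul_sub_mul ih (h m)

theorem two_pow_dvd_prod_one_sub_mul {R : Type*} [CommRing R] (x : R) (t : ℕ) :
    (2 : R) ^ t ∣ ∏ i ∈ Finset.range (2 ^ (t + 1)), (1 - i * x) - (1 - x) ^ 2 ^ t := by
  induction t with
  | zero => simp
  | succ t ih =>
    have hblock : (2 : R) ^ (t + 1) ∣
        ∏ i ∈ Finset.range (2 ^ (t + 1)), (1 - ((2 ^ (t + 1) + i : ℕ) : R) * x) -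
          ∏ i ∈ Finset.range (2 ^ (t + 1)), (1 - i * x) :=
      dvd_prod_sub_prod (fun i => ⟨-x, by push_cast; ring⟩) _
    have hsq : (2 : R) ^ (t + 1) ∣
        (∏ i ∈ Finset.range (2 ^ (t + 1)), (1 - i * x)) ^ 2 - ((1 - x) ^ 2 ^ t) ^ 2 := by
      rcases t with _ | t
      · simp [Finset.prod_range_succ]
      · obtain ⟨r, hr⟩ := ih
        refine ⟨r * (1 - x) ^ 2 ^ (t + 1) + 2 ^ t * r ^ 2, ?_⟩
        rw [eq_add_of_sub_eq hr]
        ring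
    rw [show 2 ^ (t + 1 + 1) = 2 ^ (t + 1) + 2 ^ (t + 1) by ring, Finset.prod_range_add,
      show (1 - x) ^ 2 ^ (t + 1) = ((1 - x) ^ 2 ^ t) ^ 2 by rw [← pow_mul, pow_succ 2 t]]
    obtain ⟨u, hu⟩ := hblock
    obtain ⟨v, hv⟩ := hsq
    refine ⟨(∏ i ∈ Finset.range (2 ^ (t + 1)), (1 - i * x)) * u + v, ?_⟩
    linear_combination (∏ i ∈ Finset.range (2 ^ (t + 1)), (1 - i * x)) * hu + hv

theorem prod_range_mul_of_cast_eq_zero {R : Type*} [CommRing R] (x : R) {m : ℕ} (hm : (m : R) = 0)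
    (b : ℕ) :
    ∏ i ∈ Finset.range (b * m), (1 - i * x) = (∏ i ∈ Finset.range m, (1 - i * x)) ^ b := by
  induction b with
  | zero => simp
  | succ b ih =>
    rw [Nat.succ_mul, Finset.prod_range_add, ih, pow_succ]
    simp [hm]

theorem mk_S_mul_prod (R : Type*) [CommRing R] (K : ℕ) :
    (PowerSeries.mk fun N => (S N K : R)) *
      ∏ i ∈ Finset.range (K + 1), (1 - (i : PowerSeries R) * PowerSeries.X) =
        PowerSeries.X ^ K := by
  induction K with
  | zero =>
    ext N
    rcases N with _ | N <;> simp [S, PowerSeries.coeff_one]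
  | succ K ih =>
    have hstep : (PowerSeries.mk fun N => (S N (K + 1) : R)) *
        (1 - ((K + 1 : ℕ) : PowerSeries R) * PowerSeries.X) =
        (PowerSeries.mk fun N => (S N K : R)) * PowerSeries.X := by
      ext N
      rw [← map_natCast (PowerSeries.C (R := R)), mul_sub, mul_one, ← mul_assoc, map_sub]
      rcases N with _ | N
      · simp [S]
      · rw [PowerSeries.coeff_succ_mul_X, PowerSeries.coeff_succ_mul_X, PowerSeries.coeff_mul_C]
        simp only [PowerSeries.coeff_mk, S]
        push_cast
        ring
    rw [Finset.prod_range_succ, mul_left_comm, hstep, ← mul_assoc, mul_comm (∏ i ∈ _, _), ih,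
      pow_succ]

theorem S_add_modEq (t b d a M : ℕ) (hd : d + 1 = b * 2 ^ t) :
    S (b * 2 ^ (t + 1) + M) (b * 2 ^ (t + 1) + a) ≡
      ∑ j ∈ Finset.range (M + 1), (d + j).choose j * S (M - j) a [MOD 2 ^ t] := by
  rw [← ZMod.natCast_eq_natCast_iff]
  have h2 : (2 : ZMod (2 ^ t)) ^ t = 0 := by exact_mod_cast ZMod.natCast_self (2 ^ t)
  have h2' : (2 : PowerSeries (ZMod (2 ^ t))) ^ t = 0 := by
    rw [← map_ofNat (PowerSeries.C (R := ZMod (2 ^ t))) 2, ← map_pow, h2, map_zero]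
  have hm : ((2 ^ (t + 1) : ℕ) : PowerSeries (ZMod (2 ^ t))) = 0 := by
    push_cast
    rw [pow_succ, h2', zero_mul]
  have hP := two_pow_dvd_prod_one_sub_mul (PowerSeries.X : PowerSeries (ZMod (2 ^ t))) t
  rw [h2', zero_dvd_iff, sub_eq_zero] at hP
  have hK := mk_S_mul_prod (ZMod (2 ^ t)) (b * 2 ^ (t + 1) + a)
  have ha := mk_S_mul_prod (ZMod (2 ^ t)) a
  have hH := PowerSeries.mk_add_choose_mul_one_sub_pow_eq_one (ZMod (2 ^ t)) d
  rw [add_assoc, Finset.prod_range_add, prod_range_mul_of_cast_eq_zero _ hm, hP, ← pow_mul,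
    mul_comm _ b, ← hd, pow_add PowerSeries.X, ← ha] at hK
  simp only [Nat.cast_add, Nat.cast_mul b, hm, mul_zero, zero_add] at hK
  have hu : IsUnit (∏ i ∈ Finset.range (a + 1),
      (1 - (i : PowerSeries (ZMod (2 ^ t))) * PowerSeries.X)) := by
    rw [PowerSeries.isUnit_iff_constantCoeff, map_prod]
    simp
  rw [← mul_assoc, ← mul_assoc] at hK
  have hK := hu.mul_right_cancel hK
  have key : (PowerSeries.mk fun N => (S N (b * 2 ^ (t + 1) + a) : ZMod (2 ^ t))) =
      PowerSeries.X ^ (b * 2 ^ (t + 1)) *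
        ((PowerSeries.mk fun n => ((d + n).choose d : ZMod (2 ^ t))) *
          PowerSeries.mk fun N => (S N a : ZMod (2 ^ t))) := by
    linear_combination (PowerSeries.mk fun n => ((d + n).choose d : ZMod (2 ^ t))) * hK -
      (PowerSeries.mk fun N => (S N (b * 2 ^ (t + 1) + a) : ZMod (2 ^ t))) * hH
  have := congrArg (PowerSeries.coeff (b * 2 ^ (t + 1) + M)) key
  rw [PowerSeries.coeff_mk, add_comm, PowerSeries.coeff_X_pow_mul, PowerSeries.coeff_mul,
    Finset.Nat.sum_antidiagonal_eq_sum_range_succ_mk] at this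
  rw [add_comm, this, Nat.cast_sum]
  refine Finset.sum_congr rfl fun j _ => ?_
  rw [PowerSeries.coeff_mk, PowerSeries.coeff_mk, Nat.cast_mul, Nat.choose_symm_add]

theorem s₂_eq_mod_add_div (a : ℕ) : s₂ a = a % 2 + s₂ (a / 2) := by
  rcases Nat.eq_zero_or_pos a with rfl | h
  · simp [s₂]
  · rw [s₂, Nat.digits_def' one_lt_two h, List.sum_cons, s₂]

theorem s₂_eq_mod_two_pow_add_div (a k : ℕ) : s₂ a = s₂ (a % 2 ^ k) + s₂ (a / 2 ^ k) := by
  induction k generalizing a with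
  | zero => simp [s₂, Nat.mod_one]
  | succ k ih =>
    rw [s₂_eq_mod_add_div a, ih (a / 2), s₂_eq_mod_add_div (a % 2 ^ (k + 1)), Nat.div_div_eq_div_mul,
      ← pow_succ', pow_succ' 2 k, Nat.mod_mul_right_div_self, Nat.mod_mul_right_mod, add_assoc]

theorem s₂_le_of_lt {a k : ℕ} (h : a < 2 ^ k) : s₂ a ≤ k := by
  induction k generalizing a with
  | zero =>
    obtain rfl : a = 0 := by simpa using h
    simp [s₂]
  | succ k ih =>
    rw [s₂_eq_mod_add_div]
    have := ih (a := a / 2) (by rw [pow_succ] at h; omega)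
    omega

theorem s₂_two_pow_sub_one (k : ℕ) : s₂ (2 ^ k - 1) = k := by
  induction k with
  | zero => simp [s₂]
  | succ k ih =>
    have := Nat.one_le_two_pow (n := k)
    rw [s₂_eq_mod_add_div, show (2 ^ (k + 1) - 1) / 2 = 2 ^ k - 1 by rw [pow_succ]; omega, ih,
      pow_succ]
    omega

theorem two_pow_sub_dvd_choose {t e o d : ℕ} (ho : Odd o) (hd : 2 ^ t ∣ d + 1) :
    2 ^ (t - e) ∣ (d + 2 ^ e * o).choose (2 ^ e * o) := by
  rcases le_or_gt t e with h | h
  · simp [Nat.sub_eq_zero_of_le h]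
  obtain ⟨i, hi⟩ : ∃ i, 2 ^ e * o = i + 1 :=
    Nat.exists_eq_succ_of_ne_zero (mul_ne_zero (by positivity) (Nat.ne_of_odd_add ho))
  have hc := Nat.choose_succ_right_eq (d + (i + 1)) i
  rw [show d + (i + 1) - i = d + 1 by omega, ← hi] at hc
  have h1 : 2 ^ e * 2 ^ (t - e) ∣ 2 ^ e * (o * (d + 2 ^ e * o).choose (2 ^ e * o)) := by
    rw [← pow_add, Nat.add_sub_cancel' h.le, ← mul_assoc, mul_comm, hc]
    exact hd.mul_left _
  exact (Nat.coprime_two_left.2 ho).pow_left _ |>.dvd_of_dvd_mul_left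
    (Nat.dvd_of_mul_dvd_mul_left (by positivity) h1)

theorem two_pow_dvd_term {n t e o d a M : ℕ} (he : e ≤ n) (ha : a < 2 ^ (n + 1)) (ho : Odd o)
    (hd : 2 ^ t ∣ d + 1) (hM : 2 ^ e ∣ M)
    (h : ∀ c, 2 ^ s₂ (a % 2 ^ (e + 1)) ∣ 2 * S (c * 2 ^ e) a) :
    2 ^ (s₂ a + (t - e) - (n - e)) ∣
      (d + 2 ^ e * o).choose (2 ^ e * o) * (2 * S (M - 2 ^ e * o) a) := by
  obtain ⟨c, hc⟩ : 2 ^ e ∣ M - 2 ^ e * o := Nat.dvd_sub hM (dvd_mul_right _ _)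
  have hs := s₂_eq_mod_two_pow_add_div a (e + 1)
  have hs' : s₂ (a / 2 ^ (e + 1)) ≤ n - e := s₂_le_of_lt <| by
    rw [Nat.div_lt_iff_lt_mul (by positivity), ← pow_add]
    rwa [show n - e + (e + 1) = n + 1 by omega]
  refine (pow_dvd_pow 2 (by omega : _ ≤ t - e + s₂ (a % 2 ^ (e + 1)))).trans ?_
  rw [hc, mul_comm (2 ^ e) c, pow_add]
  exact mul_dvd_mul (two_pow_sub_dvd_choose ho hd) (h c)

theorem two_pow_s₂_mod_dvd (n c K : ℕ) : 2 ^ s₂ (K % 2 ^ (n + 1)) ∣ 2 * S (c * 2 ^ n) K := by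
  induction n using Nat.strong_induction_on generalizing c K with
  | _ n ih =>
    have ha : K % 2 ^ (n + 1) < 2 ^ (n + 1) := Nat.mod_lt _ (by positivity)
    have hK := Nat.div_add_mod' K (2 ^ (n + 1))
    generalize K % 2 ^ (n + 1) = a at ha hK ⊢
    generalize K / 2 ^ (n + 1) = b at hK
    subst hK
    rcases Nat.eq_zero_or_pos b with rfl | hb
    · rw [zero_mul, zero_add]
      exact_mod_cast two_pow_s₂_dvd_of_lt (c := c) ha
    rcases lt_or_ge (c * 2 ^ n) (b * 2 ^ (n + 1) + a) with h | h
    · simp [S_eq_zero_of_lt h]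
    obtain ⟨M, hM⟩ := Nat.exists_eq_add_of_le ((Nat.le_add_right _ _).trans h)
    have hM' : 2 ^ n ∣ M :=
      (Nat.dvd_add_right ((pow_dvd_pow 2 n.le_succ).mul_left b)).1 (hM ▸ dvd_mul_left _ _)
    obtain ⟨d, hd⟩ : ∃ d, b * 2 ^ n = d + 1 :=
      Nat.exists_eq_succ_of_ne_zero (mul_ne_zero hb.ne' (by positivity))
    have hmod := (S_add_modEq n b d a M hd.symm).mul_left' 2
    rw [← pow_succ'] at hmod
    rw [hM, (hmod.of_dvd (pow_dvd_pow 2 (s₂_le_of_lt ha))).dvd_iff dvd_rfl, Finset.mul_sum]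
    refine Finset.dvd_sum fun j hj => ?_
    rw [Nat.mul_left_comm]
    by_cases hj' : 2 ^ n ∣ j
    · obtain ⟨q, hq⟩ := Nat.dvd_sub hM' hj'
      rw [hq, mul_comm (2 ^ n) q]
      exact Dvd.dvd.mul_left (by exact_mod_cast two_pow_s₂_dvd_of_lt (c := q) ha) _
    · obtain ⟨e, o, ho, rfl⟩ := Nat.exists_eq_two_pow_mul_odd (n := j) (by rintro rfl; simp at hj')
      have he : e < n := by
        by_contra! he
        exact hj' ((pow_dvd_pow 2 he).mul_right _)
      have := two_pow_dvd_term he.le ha ho (hd ▸ dvd_mul_left (2 ^ n) b)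
        ((pow_dvd_pow 2 he.le).trans hM') fun c => ih e he c a
      rwa [Nat.add_sub_cancel] at this

theorem choose_mul_two_pow_modEq (k u v : ℕ) :
    ((u + 1) * 2 ^ k - 1).choose (v * 2 ^ k) ≡ u.choose v [MOD 2] := by
  induction k with
  | zero => simp [Nat.ModEq.refl]
  | succ k ih =>
    have h := Choose.choose_modEq_choose_mod_mul_choose_div_nat (p := 2)
      (n := (u + 1) * 2 ^ (k + 1) - 1) (k := v * 2 ^ (k + 1))
    have h1 : 0 < (u + 1) * 2 ^ k := by positivity
    rw [pow_succ, ← mul_assoc, ← mul_assoc, Nat.mul_mod_left, Nat.mul_div_cancel _ two_pos,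
      show ((u + 1) * 2 ^ k * 2 - 1) / 2 = (u + 1) * 2 ^ k - 1 by omega, Nat.choose_zero_right,
      one_mul] at h
    rw [pow_succ, ← mul_assoc, ← mul_assoc]
    exact h.trans ih

theorem odd_choose_of_lt {c p b : ℕ} (hc : 0 < c) (hb : b < 2 ^ p) :
    Odd ((c * 2 ^ p - 1).choose b) := by
  induction p generalizing b with
  | zero =>
    obtain rfl : b = 0 := by simpa using hb
    simp
  | succ p ih =>
    have h := Choose.choose_modEq_choose_mod_mul_choose_div_nat (p := 2)
      (n := c * 2 ^ (p + 1) - 1) (k := b)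
    have h1 : 0 < c * 2 ^ p := by positivity
    rw [pow_succ, ← mul_assoc] at h
    rw [show (c * 2 ^ p * 2 - 1) / 2 = c * 2 ^ p - 1 by omega,
      show (c * 2 ^ p * 2 - 1) % 2 = 1 by omega] at h
    have h2 : Nat.choose 1 (b % 2) = 1 := by
      rcases Nat.mod_two_eq_zero_or_one b with h | h <;> simp [h]
    rw [h2, one_mul] at h
    rw [pow_succ, ← mul_assoc, Nat.odd_iff, h, ← Nat.odd_iff]
    exact ih (by rw [pow_succ] at hb; omega)

theorem even_choose_of_lt {c p b : ℕ} (hc : 0 < c) (hb : b + 1 < 2 ^ p) :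
    Even ((c * 2 ^ p).choose (b + 1)) := by
  have h1 := odd_choose_of_lt hc hb
  have h2 := odd_choose_of_lt hc (b.lt_succ_self.trans hb)
  obtain ⟨q, hq⟩ : ∃ q, c * 2 ^ p = q + 1 := Nat.exists_eq_succ_of_ne_zero (by positivity)
  rw [hq, Nat.add_sub_cancel] at h1 h2
  rw [hq, Nat.choose_succ_succ]
  exact h2.add_odd h1

theorem sum_range_choose_add (b I : ℕ) :
    ∑ i ∈ Finset.range (I + 1), (b + i).choose i = (b + I + 1).choose (b + 1) := by
  rw [add_comm b I, ← Nat.sum_range_add_choose]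
  refine Finset.sum_congr rfl fun i _ => ?_
  rw [← Nat.choose_symm_add, add_comm]

theorem sum_range_ite_dvd {β : Type*} [AddCommMonoid β] {q r : ℕ} (I : ℕ) (hr : r < q)
    (g : ℕ → β) :
    ∑ j ∈ Finset.range (q * I + r + 1), (if q ∣ j then g (j / q) else 0) =
      ∑ i ∈ Finset.range (I + 1), g i := by
  have hq : 0 < q := Nat.zero_lt_of_lt hr
  rw [← Finset.sum_filter]
  refine Finset.sum_nbij' (· / q) (q * ·) ?_ ?_ ?_ ?_ ?_
  · intro j hj
    rw [Finset.mem_filter, Finset.mem_range] at hj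
    rw [Finset.mem_range, Nat.div_lt_iff_lt_mul hq]
    nlinarith
  · intro i hi
    rw [Finset.mem_range] at hi
    rw [Finset.mem_filter, Finset.mem_range]
    exact ⟨by nlinarith, dvd_mul_right _ _⟩
  · intro j hj
    exact Nat.mul_div_cancel' (Finset.mem_filter.1 hj).2
  · intro i _
    exact Nat.mul_div_cancel_left i hq
  · intro j _
    rfl

theorem S_pos {N K : ℕ} (hK : 0 < K) (h : K ≤ N) : 0 < S N K := by
  induction N generalizing K with
  | zero => omega
  | succ N ih =>
    obtain ⟨K, rfl⟩ := Nat.exists_eq_succ_of_ne_zero hK.ne'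
    rw [Nat.succ_eq_add_one, S]
    rcases Nat.lt_or_ge K N with h' | h'
    · have := ih (K := K + 1) (by omega) (by omega)
      positivity
    · obtain rfl : K = N := by omega
      rcases Nat.eq_zero_or_pos K with rfl | h0
      · simp [S]
      · have := ih h0 le_rfl
        positivity

theorem two_pow_succ_s₂_dvd_sub {n a r : ℕ} (ha : 0 < a) (ha' : a < 2 ^ (n + 2)) :
    (2 : ℤ) ^ (s₂ a + 1) ∣ 2 * S ((2 * r + 1) * 2 ^ (n + 1)) a - 2 ^ s₂ a *
      ((if a ≤ 2 ^ (n + 1) then 1 else 0) + if a = 2 ^ (n + 2) - 1 ∧ 0 < r then 1 else 0) := by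
  have hp : 2 ^ (n + 2) = 2 * 2 ^ (n + 1) := pow_succ' 2 (n + 1)
  have hp' : 2 ^ (n + 1) = 2 * 2 ^ n := pow_succ' 2 n
  have := Nat.one_le_two_pow (n := n)
  rcases le_or_gt a (2 ^ (n + 1)) with h | h
  · rw [if_pos h, if_neg (by omega), add_zero, mul_one]
    exact two_pow_succ_s₂_dvd_of_le (by omega) ha h
  · rw [if_neg (by omega), zero_add]
    rcases Nat.eq_zero_or_pos r with rfl | hr
    · rw [S_eq_zero_of_lt (by omega)]
      simp
    · simp only [hr, and_true]
      exact two_pow_succ_s₂_dvd_of_gt ⟨r, rfl⟩ (by omega) h ha'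

theorem two_pow_succ_s₂_dvd_S_sub_sum {n a b I : ℕ} (ha : 0 < a) (ha' : a < 2 ^ (n + 2)) :
    (2 : ℤ) ^ (s₂ a + 1) ∣
      2 * S ((b + 1) * 2 ^ (n + 3) + (2 ^ (n + 2) * I + 2 ^ (n + 1))) ((b + 1) * 2 ^ (n + 3) + a) -
      2 ^ s₂ a * ∑ i ∈ Finset.range (I + 1), ((b + i).choose i : ℤ) *
        ((if a ≤ 2 ^ (n + 1) then 1 else 0) +
          if a = 2 ^ (n + 2) - 1 ∧ 0 < I - i then 1 else 0) := by
  have hlt : 2 ^ (n + 1) < 2 ^ (n + 2) := Nat.pow_lt_pow_right one_lt_two (Nat.lt_succ_self _)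
  have hM : ∀ e ≤ n + 1, 2 ^ e ∣ 2 ^ (n + 2) * I + 2 ^ (n + 1) := fun e he =>
    dvd_add ((pow_dvd_pow 2 (by omega)).mul_right _) (pow_dvd_pow 2 he)
  obtain ⟨d, hd⟩ : ∃ d, (b + 1) * 2 ^ (n + 2) = d + 1 :=
    Nat.exists_eq_succ_of_ne_zero (by positivity)
  have hmod := (S_add_modEq (n + 2) (b + 1) d a (2 ^ (n + 2) * I + 2 ^ (n + 1)) hd.symm).mul_left' 2
  rw [← pow_succ'] at hmod
  have hmod := Nat.modEq_iff_dvd.1 (hmod.of_dvd (pow_dvd_pow 2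
    (Nat.add_le_add_right (s₂_le_of_lt ha') 1))).symm
  push_cast at hmod
  refine (dvd_add hmod ?_).trans (by rw [sub_add_sub_cancel])
  rw [← sum_range_ite_dvd I hlt, Finset.mul_sum, Finset.mul_sum, ← Finset.sum_sub_distrib]
  refine Finset.dvd_sum fun j hj => ?_
  rw [mul_left_comm]
  by_cases h : 2 ^ (n + 2) ∣ j
  · rw [if_pos h]
    obtain ⟨i, rfl⟩ := h
    rw [Nat.mul_div_cancel_left i (by positivity)]
    have hi : i ≤ I := by
      rw [Finset.mem_range] at hj
      nlinarith
    have hS : 2 ^ (n + 2) * I + 2 ^ (n + 1) - 2 ^ (n + 2) * i = (2 * (I - i) + 1) * 2 ^ (n + 1) := by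
      obtain ⟨r, rfl⟩ := Nat.exists_eq_add_of_le hi
      rw [Nat.add_sub_cancel_left]
      refine Nat.sub_eq_of_eq_add ?_
      ring
    have hc := choose_mul_two_pow_modEq (n + 2) (b + i) i
    rw [show (b + i + 1) * 2 ^ (n + 2) - 1 = d + 2 ^ (n + 2) * i by
      refine Nat.sub_eq_of_eq_add ?_
      linear_combination hd, mul_comm i] at hc
    obtain ⟨u, hu⟩ := Nat.modEq_iff_dvd.1 hc.symm
    obtain ⟨v, hv⟩ := two_pow_succ_s₂_dvd_sub (r := I - i) ha ha'
    generalize (_ + ite (a = 2 ^ (n + 2) - 1 ∧ 0 < I - i) (1 : ℤ) 0) = σ at hv ⊢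
    rw [hS, eq_add_of_sub_eq hv, eq_add_of_sub_eq hu]
    exact ⟨u * σ + v * ((b + i).choose i + 2 * u), by push_cast; ring⟩
  · rw [if_neg h, mul_zero, sub_zero]
    obtain ⟨e, o, ho, rfl⟩ := Nat.exists_eq_two_pow_mul_odd (n := j) (by rintro rfl; simp at h)
    have he : e ≤ n + 1 := by
      by_contra! he
      exact h ((pow_dvd_pow 2 he).mul_right _)
    have := two_pow_dvd_term he ha' ho (hd ▸ dvd_mul_left (2 ^ (n + 2)) (b + 1)) (hM e he)
      fun c => two_pow_s₂_mod_dvd e c a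
    rw [show s₂ a + (n + 2 - e) - (n + 1 - e) = s₂ a + 1 by omega] at this
    exact_mod_cast this

theorem two_pow_succ_s₂_dvd_S_sub {n a b c p : ℕ} (ha : 0 < a) (ha' : a < 2 ^ (n + 2))
    (hc : 0 < c) (hb : b + 1 < 2 ^ p) :
    (2 : ℤ) ^ (s₂ a + 1) ∣
      2 * S (c * 2 ^ (p + n + 2) + (b + 1) * 2 ^ (n + 2) + 2 ^ (n + 1)) ((b + 1) * 2 ^ (n + 3) + a) -
      2 ^ s₂ a * if a = 2 ^ (n + 2) - 1 then 1 else 0 := by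
  obtain ⟨I, hI⟩ : ∃ I, c * 2 ^ p = b + 1 + I + 1 := Nat.exists_eq_add_of_lt
    (hb.trans_le (Nat.le_mul_of_pos_left _ hc))
  have hN : c * 2 ^ (p + n + 2) + (b + 1) * 2 ^ (n + 2) + 2 ^ (n + 1) =
      (b + 1) * 2 ^ (n + 3) + (2 ^ (n + 2) * (I + 1) + 2 ^ (n + 1)) := by
    linear_combination 2 ^ (n + 2) * hI
  have he : Even (∑ i ∈ Finset.range (I + 1 + 1), (b + i).choose i) := by
    rw [sum_range_choose_add, show b + (I + 1) + 1 = c * 2 ^ p by omega]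
    exact even_choose_of_lt hc hb
  have ho : Odd (∑ i ∈ Finset.range (I + 1), (b + i).choose i) := by
    rw [sum_range_choose_add, show b + I + 1 = c * 2 ^ p - 1 by omega]
    exact odd_choose_of_lt hc hb
  have hsum : (2 : ℤ) ∣ ∑ i ∈ Finset.range (I + 1 + 1), ((b + i).choose i : ℤ) *
        ((if a ≤ 2 ^ (n + 1) then 1 else 0) +
          if a = 2 ^ (n + 2) - 1 ∧ 0 < I + 1 - i then 1 else 0) -
      if a = 2 ^ (n + 2) - 1 then 1 else 0 := by
    have h1 : 2 ^ (n + 2) = 2 ^ (n + 1) + 2 ^ n * 2 := by ring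
    have h2 := Nat.one_le_two_pow (n := n)
    simp only [mul_add, Finset.sum_add_distrib, ← Finset.sum_mul]
    by_cases h : a = 2 ^ (n + 2) - 1
    · rw [if_neg (by rw [pow_succ] at *; omega), if_pos h, mul_zero, zero_add,
        Finset.sum_range_succ]
      have : ∀ i ∈ Finset.range (I + 1), ((b + i).choose i : ℤ) *
          (if a = 2 ^ (n + 2) - 1 ∧ 0 < I + 1 - i then 1 else 0) = ((b + i).choose i : ℤ) := by
        intro i hi
        rw [Finset.mem_range] at hi
        rw [if_pos ⟨h, by omega⟩, mul_one]
      rw [Finset.sum_congr rfl this]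
      obtain ⟨u, hu⟩ := ho
      zify at hu
      simp [hu]
    · obtain ⟨u, hu⟩ := he
      zify at hu
      simp only [h, false_and, if_false, mul_zero, Finset.sum_const_zero, add_zero, sub_zero]
      refine Dvd.dvd.mul_right ?_ _
      exact ⟨u, by rw [hu, two_mul]⟩
  rw [hN]
  have hsum' := mul_dvd_mul_left (2 ^ s₂ a) hsum
  rw [← pow_succ, mul_sub] at hsum'
  have := dvd_add (two_pow_succ_s₂_dvd_S_sub_sum (b := b) (I := I + 1) ha ha') hsum'
  rwa [sub_add_sub_cancel] at this

theorem stmt4 (a b c m n : ℕ) (ha0 : 1 ≤ a) (ha : a < 2 ^ (n + 1))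
    (hb : 0 < b) (hc : 0 < c) (hn : 0 < n)
    (hm : n + 2 + Nat.log 2 b ≤ m) (hodd : Odd c) :
    (a = 2 ^ (n + 1) - 1 →
      padicValNat 2 (S (c * 2 ^ m + b * 2 ^ (n + 1) + 2 ^ n) (b * 2 ^ (n + 2) + a)) = n) ∧
    (a < 2 ^ (n + 1) - 1 →
      s₂ a ≤ padicValNat 2 (S (c * 2 ^ m + b * 2 ^ (n + 1) + 2 ^ n) (b * 2 ^ (n + 2) + a))) := by
  obtain ⟨n, rfl⟩ : ∃ k, n = k + 1 := Nat.exists_eq_succ_of_ne_zero hn.ne'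
  obtain ⟨b, rfl⟩ : ∃ k, b = k + 1 := Nat.exists_eq_succ_of_ne_zero hb.ne'
  obtain ⟨p, rfl⟩ : ∃ p, m = p + n + 2 := ⟨m - (n + 2), by omega⟩
  have hb' : b + 1 < 2 ^ p := (Nat.lt_pow_succ_log_self one_lt_two _).trans_le
    (Nat.pow_le_pow_right two_pos (by omega))
  have key := two_pow_succ_s₂_dvd_S_sub ha0 ha hc hb'
  have hpos : S (c * 2 ^ (p + n + 2) + (b + 1) * 2 ^ (n + 2) + 2 ^ (n + 1))
      ((b + 1) * 2 ^ (n + 3) + a) ≠ 0 := by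
    refine (S_pos (by positivity) ?_).ne'
    have h1 : (b + 1 + 1) * 2 ^ (n + 2) ≤ c * 2 ^ p * 2 ^ (n + 2) :=
      Nat.mul_le_mul_right _ (hb'.trans_le (Nat.le_mul_of_pos_left _ hc))
    rw [show c * 2 ^ (p + n + 2) = c * 2 ^ p * 2 ^ (n + 2) by ring, pow_succ 2 (n + 2)]
    have h2 : a < 2 ^ (n + 2) := ha
    linarith [Nat.zero_le (2 ^ (n + 1))]
  change (_ → padicValNat 2 (S _ ((b + 1) * 2 ^ (n + 3) + a)) = _) ∧
    (_ → _ ≤ padicValNat 2 (S _ ((b + 1) * 2 ^ (n + 3) + a)))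
  generalize S (c * 2 ^ (p + n + 2) + (b + 1) * 2 ^ (n + 2) + 2 ^ (n + 1))
      ((b + 1) * 2 ^ (n + 3) + a) = x at key hpos ⊢
  constructor
  · intro h
    rw [if_pos h, h, s₂_two_pow_sub_one, mul_one] at key
    obtain ⟨v, hv⟩ := key
    have hx : (x : ℤ) = 2 ^ (n + 1) * (2 * v + 1) := by
      rw [pow_succ _ (n + 2), pow_succ _ (n + 1)] at hv
      linarith
    refine le_antisymm ?_ ((padicValNat_dvd_iff_le hpos).1 ?_)
    · rw [← Nat.lt_succ_iff, ← not_le, ← padicValNat_dvd_iff_le hpos]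
      intro h
      zify at h
      rw [hx, pow_succ, mul_dvd_mul_iff_left (by positivity)] at h
      omega
    · zify
      exact ⟨_, hx⟩
  · intro h
    rw [if_neg h.ne, mul_zero, sub_zero, pow_succ', mul_dvd_mul_iff_left two_ne_zero] at key
    refine (padicValNat_dvd_iff_le hpos).1 ?_
    exact_mod_cast key
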